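/- Let k be a C_1 field, i.e., for all integers N > d ≥ 1, every homogeneous polynomial of degree d in N variables over k has a nontrivial zero in k^N. Let f_1, …, f_r ∈ k[X_0, …, X_n] be homogeneous polynomials of respective degrees d_1, …, d_r with d_i ≥ 1 for all i and ∑_{i=1}^r d_i² ≤ n. Let a, b ∈ k^{n+1} be linearly independent vectors satisfying f_i(a) = 0 and f_i(b) = 0 for all i = 1, …, r. Then there exists a nonzero vector c ∈ k^{n+1} such that for every i = 1, …, r, the polynomial f_i(s·a + t·c) obtained by substituting X_m ↦ s·a_m + t·c_m is the zero polynomial of k[s,t], and likewise the polynomial f_i(s·b + t·c) is the zero polynomial of k[s,t]. (In particular f_i(c) = 0 for all i, and the projective lines through the point c and each of the points a, b are contained in the common projective zero set of f_1, …, f_r.) -/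

import Mathlib

open MvPolynomial


/-- Growth lemma: two coprime generators with exponent `b` force exponent `γ < b` everywhere. -/
theorem growth_aux (mu : ℕ → ℝ) (h1 : ∀ d, 1 ≤ d → 1 ≤ mu d)
    (hmul : ∀ a b, 1 ≤ a → 1 ≤ b → mu a * mu b ≤ mu (a * b))
    (hadd : ∀ a b, 1 ≤ a → 1 ≤ b → min (mu a) (mu b) ≤ mu (a + b))
    (P R : ℕ) (hP : 1 ≤ P) (hR : 1 ≤ R) (hco : Nat.Coprime P R)
    (γ : ℝ) (hγ0 : 0 ≤ γ) (hγ1 : γ ≤ 1)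
    (hPm : 4 * (P : ℝ) ^ γ ≤ mu P) (hRm : 4 * (R : ℝ) ^ γ ≤ mu R) :
    ∃ c : ℝ, 0 < c ∧ ∀ n : ℕ, 1 ≤ n → c * (n : ℝ) ^ γ ≤ mu n := by
  have hPR : (0 : ℝ) < 4 * P * R := by positivity
  refine ⟨(4 * P * R : ℝ)⁻¹, by positivity, ?_⟩
  set c := (4 * P * R : ℝ)⁻¹ with hc
  have hc0 : 0 < c := by positivity
  intro n
  induction n using Nat.strong_induction_on with
  | _ n ih =>
    intro hn
    by_cases hlt : n < 4 * P * R
    · have hn1 : (1 : ℝ) ≤ n := by exact_mod_cast hn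
      have : (n : ℝ) ^ γ ≤ 4 * P * R := by
        calc (n : ℝ) ^ γ ≤ (n : ℝ) ^ (1 : ℝ) := Real.rpow_le_rpow_of_exponent_le hn1 hγ1
          _ = n := Real.rpow_one _
          _ ≤ 4 * P * R := by exact_mod_cast hlt.le
      calc c * (n : ℝ) ^ γ ≤ c * (4 * P * R) := by gcongr
        _ = 1 := by rw [hc]; field_simp
        _ ≤ mu n := h1 n hn
    · push Not at hlt
      -- choose n₂ in a window
      obtain ⟨n₁, n₂, hsum, hn₁, hn₂⟩ : ∃ n₁ n₂ : ℕ, P * n₁ + R * n₂ = n ∧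
          n ≤ 4 * (P * n₁) ∧ n ≤ 4 * (R * n₂) := by
        obtain ⟨u, hu1, hu2⟩ : ∃ u : ℕ, n ≤ 4 * (R * u) ∧ 4 * (R * u) ≤ n + 4 * R := by
          refine ⟨n / (4 * R) + 1, ?_, ?_⟩
          · have := Nat.lt_mul_div_succ n (show 0 < 4 * R by omega)
            nlinarith
          · have := Nat.mul_div_le n (4 * R)
            nlinarith
        have hu3 : R * u ≤ n := by nlinarith
        -- want j < P with P ∣ n - R (u + j)
        obtain ⟨x, -, hx⟩ := Nat.exists_mul_mod_eq_of_coprime (n - R * u) hco.symm (by omega : P ≠ 0)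
        obtain ⟨j, hjP, hj⟩ : ∃ j, j < P ∧ R * j ≡ n - R * u [MOD P] := by
          refine ⟨x % P, Nat.mod_lt _ hP, ?_⟩
          have : R * (x % P) ≡ R * x [MOD P] := (Nat.mod_modEq x P).mul_left R
          exact this.trans hx
        have hj2 : R * (u + j) ≤ n := by
          have : R * j + R ≤ R * P := by nlinarith
          nlinarith
        have hjd : R * j ≤ n - R * u := by rw [Nat.le_sub_iff_add_le hu3]; nlinarith
        obtain ⟨q, hq⟩ := (Nat.modEq_iff_dvd' hjd).1 hj
        have e1 : P * q + R * (u + j) = n := by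
          rw [mul_add]; omega
        refine ⟨q, u + j, e1, ?_, ?_⟩
        · have : R * j + R ≤ R * P := by nlinarith
          nlinarith
        · nlinarith
      have hn0 : 0 < n := hn
      have p1 : 1 ≤ n₁ := by
        rcases Nat.eq_zero_or_pos n₁ with h | h
        · subst h; omega
        · exact h
      have p2 : 1 ≤ n₂ := by
        rcases Nat.eq_zero_or_pos n₂ with h | h
        · subst h; omega
        · exact h
      have l1 : n₁ < n := by nlinarith
      have l2 : n₂ < n := by nlinarith
      have key : ∀ (Z z : ℕ), 1 ≤ Z → 1 ≤ z → z < n → n ≤ 4 * (Z * z) →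
          4 * (Z : ℝ) ^ γ ≤ mu Z → c * (n : ℝ) ^ γ ≤ mu (Z * z) := by
        intro Z z hZ hz hzn hle hZm
        have i1 := ih z hzn hz
        have i2 : (n : ℝ) ^ γ ≤ 4 * ((Z : ℝ) ^ γ * (z : ℝ) ^ γ) := by
          calc (n : ℝ) ^ γ ≤ (4 * (Z * z) : ℝ) ^ γ := by
                apply Real.rpow_le_rpow (by positivity) _ hγ0
                exact_mod_cast hle
            _ = (4 : ℝ) ^ γ * ((Z : ℝ) ^ γ * (z : ℝ) ^ γ) := by
                rw [Real.mul_rpow (by positivity) (by positivity),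
                  Real.mul_rpow (by positivity) (by positivity)]
            _ ≤ (4 : ℝ) ^ (1 : ℝ) * ((Z : ℝ) ^ γ * (z : ℝ) ^ γ) := by
                gcongr
                · norm_num
            _ = _ := by rw [Real.rpow_one]
        calc c * (n : ℝ) ^ γ ≤ c * (4 * ((Z : ℝ) ^ γ * (z : ℝ) ^ γ)) := by gcongr
          _ = (4 * (Z : ℝ) ^ γ) * (c * (z : ℝ) ^ γ) := by ring
          _ ≤ mu Z * mu z := by
              apply mul_le_mul hZm i1 (by positivity)
              linarith [h1 Z hZ]
          _ ≤ mu (Z * z) := hmul Z z hZ hz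
      rw [← hsum] at *
      exact (le_min (key P n₁ hP p1 l1 hn₁ hPm) (key R n₂ hR p2 l2 hn₂ hRm)).trans
        (hadd _ _ (by nlinarith) (by nlinarith))

theorem mu_pow_le (mu : ℕ → ℝ) (h1 : ∀ d, 1 ≤ d → 1 ≤ mu d)
    (hmul : ∀ a b, 1 ≤ a → 1 ≤ b → mu a * mu b ≤ mu (a * b)) (a : ℕ) (ha : 1 ≤ a) (x : ℕ) :
    mu a ^ x ≤ mu (a ^ x) := by
  induction x with
  | zero => simpa using h1 1 le_rfl
  | succ x ih =>
    rw [pow_succ, pow_succ]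
    refine le_trans ?_ (hmul _ _ (Nat.one_le_pow _ _ ha) ha)
    have := h1 a ha
    gcongr

theorem growth (mu : ℕ → ℝ) (h1 : ∀ d, 1 ≤ d → 1 ≤ mu d)
    (hmul : ∀ a b, 1 ≤ a → 1 ≤ b → mu a * mu b ≤ mu (a * b))
    (hadd : ∀ a b, 1 ≤ a → 1 ≤ b → min (mu a) (mu b) ≤ mu (a + b))
    (P R : ℕ) (hP : 2 ≤ P) (hR : 2 ≤ R) (hco : Nat.Coprime P R)
    (γ b : ℝ) (hb : γ < b) (hγ1 : γ ≤ 1)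
    (hPm : (P : ℝ) ^ b ≤ mu P) (hRm : (R : ℝ) ^ b ≤ mu R) :
    ∃ c : ℝ, 0 < c ∧ ∀ n : ℕ, 1 ≤ n → c * (n : ℝ) ^ γ ≤ mu n := by
  by_cases hγ0 : γ < 0
  · refine ⟨1, one_pos, fun n hn => ?_⟩
    rw [one_mul]
    exact (Real.rpow_le_one_of_one_le_of_nonpos (by exact_mod_cast hn) hγ0.le).trans (h1 n hn)
  push Not at hγ0
  obtain ⟨x, hx⟩ : ∃ x : ℕ, (4 : ℝ) ≤ ((2 : ℝ) ^ (b - γ)) ^ x := by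
    have : (1 : ℝ) < (2 : ℝ) ^ (b - γ) := Real.one_lt_rpow (by norm_num) (by linarith)
    obtain ⟨x, hx⟩ := pow_unbounded_of_one_lt 4 this
    exact ⟨x, hx.le⟩
  have key : ∀ Z : ℕ, 2 ≤ Z → (Z : ℝ) ^ b ≤ mu Z →
      4 * ((Z ^ x : ℕ) : ℝ) ^ γ ≤ mu (Z ^ x) := by
    intro Z hZ hZm
    have hZ2 : (2 : ℝ) ≤ Z := by exact_mod_cast hZ
    have hZ0 : (0 : ℝ) < Z := by linarith
    calc 4 * ((Z ^ x : ℕ) : ℝ) ^ γ ≤ ((2 : ℝ) ^ (b - γ)) ^ x * ((Z ^ x : ℕ) : ℝ) ^ γ := by gcongr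
      _ ≤ ((Z : ℝ) ^ (b - γ)) ^ x * ((Z ^ x : ℕ) : ℝ) ^ γ := by
          gcongr
      _ = ((Z : ℝ) ^ b) ^ x := by
          push_cast
          rw [← Real.rpow_natCast, ← Real.rpow_natCast, ← Real.rpow_natCast, ← Real.rpow_mul hZ0.le,
            ← Real.rpow_mul hZ0.le, ← Real.rpow_mul hZ0.le, ← Real.rpow_add hZ0]
          congr 1; ring
      _ ≤ mu Z ^ x := by gcongr
      _ ≤ _ := mu_pow_le mu h1 hmul Z (by omega) x
  exact growth_aux mu h1 hmul hadd (P ^ x) (R ^ x) (Nat.one_le_pow _ _ (by omega))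
    (Nat.one_le_pow _ _ (by omega)) (hco.pow _ _) γ hγ0 hγ1 (key P hP hPm) (key R hR hRm)

theorem exists_good_degree (mu : ℕ → ℝ) (h1 : ∀ d, 1 ≤ d → 1 ≤ mu d)
    (hle : ∀ d, 1 ≤ d → mu d ≤ d)
    (hmul : ∀ a b, 1 ≤ a → 1 ≤ b → mu a * mu b ≤ mu (a * b))
    (hadd : ∀ a b, 1 ≤ a → 1 ≤ b → min (mu a) (mu b) ≤ mu (a + b))
    (p : ℕ) (hp : p.Prime) (hpm : ∀ d, 1 ≤ d → mu (p * d) = p * mu d)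
    {ι : Type*} [Fintype ι] (d : ι → ℕ) (hd : ∀ i, 1 ≤ d i) (ε : ℝ) (hε : 0 < ε) :
    ∃ D : ℕ, 1 ≤ D ∧ ∀ i, ∃ q, D = d i * q ∧ 1 ≤ q ∧ mu D ≤ (1 + ε) * d i * mu q := by
  by_contra hcon
  push Not at hcon
  have hpp : ∀ (A w : ℕ), 1 ≤ w → mu (p ^ A * w) = (p : ℝ) ^ A * mu w := by
    intro A w hw
    induction A with
    | zero => simp
    | succ A ih =>
      rw [pow_succ', mul_assoc, hpm _ (Nat.mul_pos (pow_pos hp.pos _) hw), ih]; ring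
  have hdec : ∀ i, ∃ a d' : ℕ, ¬ p ∣ d' ∧ d i = p ^ a * d' := fun i =>
    Nat.exists_eq_pow_mul_and_not_dvd (by have := hd i; omega) p hp.ne_one
  choose a d' hnd hdd using hdec
  have hd'1 : ∀ i, 1 ≤ d' i := fun i => Nat.pos_of_ne_zero (fun h => hnd i (h ▸ dvd_zero p))
  set L : ℕ := (p + 1) * ∏ i, d' i with hL
  have hprod1 : 1 ≤ ∏ i, d' i :=
    Nat.succ_le_of_lt (Finset.prod_pos (fun i _ => hd'1 i))
  have hL2 : 2 ≤ L := by have := hp.two_le; nlinarith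
  have hLco : Nat.Coprime p L := by
    refine Nat.Coprime.mul_right (by simp) ?_
    exact Nat.Coprime.prod_right (fun i _ => (hp.coprime_iff_not_dvd).2 (hnd i))
  have hdL : ∀ i, d' i ∣ L := fun i =>
    (Finset.dvd_prod_of_mem d' (Finset.mem_univ i)).trans (dvd_mul_left _ _)
  -- one step
  have step : ∀ w, 1 ≤ w → (∀ i, d' i ∣ w) → ∃ i, ∃ w', w = d' i * w' ∧ 1 ≤ w' ∧
      (1 + ε) * d' i * mu w' ≤ mu w := by
    intro w hw hdw
    set A := ∑ i, a i with hA
    obtain ⟨i, hi⟩ := hcon (p ^ A * w) (Nat.mul_pos (pow_pos hp.pos _) hw)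
    obtain ⟨w', hw'⟩ := hdw i
    have hw'1 : 1 ≤ w' := Nat.pos_of_ne_zero (fun h => by subst h; omega)
    have hai : a i ≤ A := Finset.single_le_sum (f := a) (fun _ _ => Nat.zero_le _) (Finset.mem_univ i)
    refine ⟨i, w', hw', hw'1, ?_⟩
    have h2 := hi (p ^ (A - a i) * w') (by
      rw [hdd i, hw']
      conv_lhs => rw [← Nat.add_sub_cancel' hai, pow_add]
      ring) (Nat.mul_pos (pow_pos hp.pos _) hw'1)
    rw [hpp _ _ hw, hpp _ _ hw'1, hdd i] at h2
    have h3 : (p : ℝ) ^ A = (p : ℝ) ^ (a i) * (p : ℝ) ^ (A - a i) := by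
      rw [← pow_add, Nat.add_sub_cancel' hai]
    have hpA : (0 : ℝ) < (p : ℝ) ^ A := pow_pos (by exact_mod_cast hp.pos) _
    have h4 : (p : ℝ) ^ A * ((1 + ε) * d' i * mu w') ≤ (p : ℝ) ^ A * mu w := by
      refine le_trans (le_of_eq ?_) h2.le
      conv_lhs => rw [h3]
      push_cast; ring
    exact le_of_mul_le_mul_left h4 hpA
  have walk : ∀ t n, n ≤ t → ∃ w, 1 ≤ w ∧ w ≤ L ^ t ∧ L ^ (t - n) ∣ w ∧
      (1 + ε) ^ n * (L : ℝ) ^ t * mu w ≤ mu (L ^ t) * w := by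
    intro t n
    induction n with
    | zero =>
      intro _
      refine ⟨L ^ t, Nat.one_le_pow _ _ (by omega), le_rfl, by simp, ?_⟩
      push_cast; rw [pow_zero, one_mul, mul_comm]
    | succ n ih =>
      intro hnt
      obtain ⟨w, hw1, hwL, hwd, hwm⟩ := ih (by omega)
      have e : t - n = (t - (n + 1)) + 1 := by omega
      rw [e, pow_succ] at hwd
      obtain ⟨i, w', rfl, hw'1, hm⟩ := step w hw1
        (fun i => ((hdL i).trans (dvd_mul_left _ _)).trans hwd)
      refine ⟨w', hw'1, le_trans (Nat.le_mul_of_pos_left _ (hd'1 i)) hwL, ?_, ?_⟩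
      · obtain ⟨z, hz⟩ := hdL i
        have : d' i * L ^ (t - (n + 1)) ∣ d' i * w' := by
          refine dvd_trans ⟨z, ?_⟩ hwd
          conv_lhs => rw [hz]
          rw [← hz, hz]
          ring
        exact Nat.dvd_of_mul_dvd_mul_left (hd'1 i) this
      · have hdp : (0 : ℝ) < d' i := by exact_mod_cast hd'1 i
        have : (d' i : ℝ) * ((1 + ε) ^ (n + 1) * (L : ℝ) ^ t * mu w') ≤
            d' i * (mu (L ^ t) * w') := by
          calc (d' i : ℝ) * ((1 + ε) ^ (n + 1) * (L : ℝ) ^ t * mu w')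
              = (1 + ε) ^ n * (L : ℝ) ^ t * ((1 + ε) * d' i * mu w') := by ring
            _ ≤ (1 + ε) ^ n * (L : ℝ) ^ t * mu (d' i * w') := by gcongr
            _ ≤ _ := hwm
            _ = _ := by push_cast; ring
        exact le_of_mul_le_mul_left this hdp
  -- exponents
  have hLr : (1 : ℝ) < L := by exact_mod_cast (by omega : 1 < L)
  have hlogL : 0 < Real.log L := Real.log_pos hLr
  set x : ℕ → ℝ := fun t => Real.log (mu (L ^ (t + 1))) / Real.log ((L : ℝ) ^ (t + 1)) with hx
  have hx1 : ∀ t, x t ≤ 1 := by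
    intro t
    have hpos : 0 < Real.log ((L : ℝ) ^ (t + 1)) := Real.log_pos (one_lt_pow₀ hLr (by omega))
    have hg : 1 ≤ L ^ (t + 1) := Nat.one_le_pow _ _ (by omega)
    rw [hx]; simp only
    rw [div_le_one hpos]
    apply Real.log_le_log (by linarith [h1 _ hg])
    have := hle _ hg
    push_cast at this
    exact this
  have hmx : ∀ t, mu (L ^ (t + 1)) = ((L : ℝ) ^ (t + 1)) ^ (x t) := by
    intro t
    have hg : 1 ≤ L ^ (t + 1) := Nat.one_le_pow _ _ (by omega)
    have hpos : 0 < Real.log ((L : ℝ) ^ (t + 1)) := Real.log_pos (one_lt_pow₀ hLr (by omega))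
    rw [Real.rpow_def_of_pos (by positivity), hx]
    simp only
    rw [mul_div_cancel₀ _ hpos.ne', Real.exp_log (by linarith [h1 _ hg])]
  have hbdd : BddAbove (Set.range x) := ⟨1, by rintro _ ⟨t, rfl⟩; exact hx1 t⟩
  set β := ⨆ t, x t with hβ
  have hβ1 : β ≤ 1 := ciSup_le hx1
  set η := Real.log (1 + ε / 2) / Real.log L with hη
  have hη0 : 0 < η := div_pos (Real.log_pos (by linarith)) hlogL
  have hLη : (L : ℝ) ^ η = 1 + ε / 2 := by
    rw [Real.rpow_def_of_pos (by linarith), hη, mul_div_cancel₀ _ hlogL.ne',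
      Real.exp_log (by linarith)]
  obtain ⟨T, hT⟩ : ∃ T, β - η < x T := exists_lt_of_lt_ciSup (by linarith)
  obtain ⟨c, hc0, hc⟩ := growth mu h1 hmul hadd p (L ^ (T + 1)) hp.two_le
    (le_trans hL2 (Nat.le_self_pow (by omega) _)) (hLco.pow_right _) (β - η) (x T) hT
    (by linarith)
    (by
      have h0 := hpm 1 le_rfl
      have h11 : mu 1 = 1 := le_antisymm (by simpa using hle 1 le_rfl) (h1 1 le_rfl)
      rw [mul_one, h11, mul_one] at h0
      rw [h0]
      calc (p : ℝ) ^ x T ≤ (p : ℝ) ^ (1 : ℝ) :=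
            Real.rpow_le_rpow_of_exponent_le (by exact_mod_cast hp.one_le) (hx1 T)
        _ = p := Real.rpow_one _)
    (by rw [hmx T]; push_cast; exact le_rfl)
  have fin : ∀ t : ℕ, (1 + ε) ^ (t + 1) * c ≤ (1 + ε / 2) ^ (t + 1) := by
    intro t
    obtain ⟨w, hw1, hwL, -, hw⟩ := walk (t + 1) (t + 1) le_rfl
    set Xr : ℝ := (L : ℝ) ^ (t + 1) with hX
    have hX1 : 1 ≤ Xr := one_le_pow₀ hLr.le
    have hX0 : 0 < Xr := by linarith
    have hw0 : (0 : ℝ) < w := by exact_mod_cast hw1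
    have hwX : (w : ℝ) ≤ Xr := by rw [hX]; exact_mod_cast hwL
    have u1 : mu (L ^ (t + 1)) ≤ Xr ^ β := by
      rw [hmx t]
      exact Real.rpow_le_rpow_of_exponent_le hX1 (le_ciSup hbdd t)
    have u2 := hc w hw1
    have u3 : (1 + ε) ^ (t + 1) * Xr * (c * (w : ℝ) ^ (β - η)) ≤ Xr ^ β * w := by
      calc _ ≤ (1 + ε) ^ (t + 1) * Xr * mu w := by gcongr
        _ ≤ _ := hw
        _ ≤ _ := by gcongr
    have u4 : (w : ℝ) = (w : ℝ) ^ (β - η) * (w : ℝ) ^ (1 - β + η) := by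
      rw [← Real.rpow_add hw0]; ring_nf; simp
    have u5 : (w : ℝ) ^ (1 - β + η) ≤ Xr ^ (1 - β + η) :=
      Real.rpow_le_rpow hw0.le hwX (by linarith)
    have u6 : Xr ^ β * Xr ^ (1 - β + η) = Xr * Xr ^ η := by
      rw [← Real.rpow_add hX0]
      conv_rhs => rw [← Real.rpow_one_add' hX0.le (by linarith)]
      ring_nf
    have u7 : Xr ^ η = (1 + ε / 2) ^ (t + 1) := by
      rw [hX, ← Real.rpow_natCast, ← Real.rpow_mul (by linarith), mul_comm, Real.rpow_mul (by linarith),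
        hLη, Real.rpow_natCast]
    have hwp : 0 < (w : ℝ) ^ (β - η) := Real.rpow_pos_of_pos hw0 _
    have u8 : (Xr * (w : ℝ) ^ (β - η)) * ((1 + ε) ^ (t + 1) * c) ≤
        (Xr * (w : ℝ) ^ (β - η)) * (1 + ε / 2) ^ (t + 1) := by
      calc _ = (1 + ε) ^ (t + 1) * Xr * (c * (w : ℝ) ^ (β - η)) := by ring
        _ ≤ Xr ^ β * w := u3
        _ = Xr ^ β * ((w : ℝ) ^ (β - η) * (w : ℝ) ^ (1 - β + η)) := by rw [← u4]
        _ ≤ Xr ^ β * ((w : ℝ) ^ (β - η) * Xr ^ (1 - β + η)) := by gcongr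
        _ = (w : ℝ) ^ (β - η) * (Xr ^ β * Xr ^ (1 - β + η)) := by ring
        _ = _ := by rw [u6, u7]; ring
    exact le_of_mul_le_mul_left u8 (by positivity)
  have hratio : 1 < (1 + ε) / (1 + ε / 2) := by
    rw [one_lt_div (by linarith)]; linarith
  obtain ⟨t, ht⟩ := pow_unbounded_of_one_lt (1 / c) hratio
  have h5 := fin t
  have h6 : 1 / c < ((1 + ε) / (1 + ε / 2)) ^ (t + 1) :=
    ht.trans_le (pow_le_pow_right₀ hratio.le (by omega))
  rw [div_pow, div_lt_div_iff₀ hc0 (by positivity)] at h6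
  linarith


theorem algClosed_zero {k : Type*} [Field k] [IsAlgClosed k] {ι : Type*} [Fintype ι] {N : ℕ}
    (f : ι → MvPolynomial (Fin N) k) (hf0 : ∀ i, eval 0 (f i) = 0) (h : Fintype.card ι < N) :
    ∃ y : Fin N → k, y ≠ 0 ∧ ∀ i, eval y (f i) = 0 := by
  by_contra hcon
  push Not at hcon
  let φ : ℕ → (MvPolynomial (Fin N) k →ₐ[k] MvPolynomial (Fin N) k) := fun j =>
    aeval (fun i : Fin N => if i.val < j then 0 else X i)
  let P : ℕ → Ideal (MvPolynomial (Fin N) k) := fun j => RingHom.ker (φ j)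
  have hP : ∀ j, (P j).IsPrime := fun j => RingHom.ker_isPrime (φ j)
  have hle : ∀ j, P j ≤ P (j + 1) := by
    intro j x hx
    have hc : (φ (j + 1)) = (φ (j + 1)).comp (φ j) := by
      apply MvPolynomial.algHom_ext
      intro i
      simp only [φ, AlgHom.comp_apply, aeval_X]
      by_cases h1 : i.val < j
      · rw [if_pos h1, if_pos (by omega), map_zero]
      · rw [if_neg h1, aeval_X]
    have hx' : φ j x = 0 := hx
    show φ (j + 1) x = 0
    rw [hc, AlgHom.comp_apply, hx', map_zero]
  have hlt : ∀ j, j < N → P j < P (j + 1) := by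
    intro j hj
    refine lt_of_le_of_ne (hle j) (fun he => ?_)
    have h1 : (X (⟨j, hj⟩ : Fin N) : MvPolynomial (Fin N) k) ∈ P (j + 1) := by
      show φ (j + 1) (X _) = 0
      simp [φ]
    rw [← he] at h1
    have h2 : φ j (X (⟨j, hj⟩ : Fin N)) = 0 := h1
    simp [φ] at h2
  have hht : ∀ j, j ≤ N → (j : ℕ∞) ≤ (P j).height := by
    intro j
    induction j with
    | zero => intro _; simp
    | succ j ih =>
      intro hj
      have := hP j
      have h1 := ih (by omega)
      have h2 : (P j).height < (P (j + 1)).height := Ideal.height_strict_mono_of_isPrime (hlt j hj)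
      push_cast
      exact Order.add_one_le_of_lt (lt_of_le_of_lt h1 h2)
  set I := Ideal.span (Set.range f) with hI
  have hz : zeroLocus k I = {0} := by
    rw [hI, zeroLocus_span]
    ext y
    simp only [Set.mem_range, forall_exists_index, forall_apply_eq_imp_iff, Set.mem_ofPred_eq, Set.mem_singleton_iff]
    constructor
    · intro hy
      by_contra hne
      obtain ⟨i, hi⟩ := hcon y hne
      exact hi (hy i)
    · rintro rfl; exact hf0
  have hrad : I.radical = P N := by
    rw [← vanishingIdeal_zeroLocus_eq_radical (K := k), hz]
    ext q
    rw [mem_vanishingIdeal_singleton_iff]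
    have : φ N = (Algebra.ofId k _).comp (aeval (0 : Fin N → k)) := by
      apply MvPolynomial.algHom_ext
      intro i
      simp [φ]
    show _ ↔ φ N q = 0
    rw [this, AlgHom.comp_apply]
    simp [Algebra.ofId_apply]
  have hmin : P N ∈ I.minimalPrimes := by
    rw [← Ideal.radical_minimalPrimes, hrad]
    have := hP N
    rw [Ideal.minimalPrimes_eq_subsingleton_self]
    rfl
  have h3 := Ideal.height_le_card_of_mem_minimalPrimes_span (Set.finite_range f) hmin
  have h4 : (Set.range f).ncard ≤ Fintype.card ι := by
    rw [← Set.image_univ]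
    refine (Set.ncard_image_le).trans ?_
    rw [Set.ncard_univ, Nat.card_eq_fintype_card]
  have h5 := (hht N le_rfl).trans h3
  have h6 : N ≤ (Set.range f).ncard := by exact_mod_cast h5
  omega


/-- There is an anisotropic form of degree `d` in variables indexed by `σ`. -/
def AnT (k : Type*) [Field k] (σ : Type) (d : ℕ) : Prop :=
  ∃ F : MvPolynomial σ k, F.IsHomogeneous d ∧ ∀ y : σ → k, eval y F = 0 → y = 0

theorem AnT.comp_sys {k : Type*} [Field k] {τ V J : Type} {E D : ℕ} (e : J → τ)
    (he : Function.Injective e) (hΨ : AnT k τ E) (g : J → MvPolynomial V k)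
    (hg : ∀ j, (g j).IsHomogeneous D)
    (han : ∀ y : V → k, (∀ j, eval y (g j) = 0) → y = 0) : AnT k V (D * E) := by
  classical
  obtain ⟨F, hF, hF0⟩ := hΨ
  refine ⟨aeval (fun t => if h : ∃ j, e j = t then g h.choose else 0) F, ?_, ?_⟩
  · apply hF.aeval
    intro t
    split_ifs with h
    · exact hg _
    · exact isHomogeneous_zero _ _ _
  · intro y hy
    have h1 : eval y (aeval (fun t => if h : ∃ j, e j = t then g h.choose else 0) F) =
        eval (fun t => eval y (if h : ∃ j, e j = t then g h.choose else 0)) F := by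
      rw [← coe_aeval_eq_eval y, ← coe_aeval_eq_eval]
      exact DFunLike.congr_fun (MvPolynomial.algHom_ext (f := (aeval y).comp (aeval _))
        (g := aeval (fun t => aeval y (if h : ∃ j, e j = t then g h.choose else 0)))
        (fun i => by simp only [AlgHom.comp_apply, aeval_X])) F
    rw [h1] at hy
    have h2 := hF0 _ hy
    apply han
    intro j
    have h3 := congrFun h2 (e j)
    have hex : ∃ j', e j' = e j := ⟨j, rfl⟩
    simp only [dif_pos hex, Pi.zero_apply] at h3
    rwa [he hex.choose_spec] at h3

theorem AnT.restrict {k : Type*} [Field k] {σ τ : Type} {d : ℕ} (e : σ → τ)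
    (he : Function.Injective e) (h : AnT k τ d) : AnT k σ d := by
  have := h.comp_sys e he (fun s => (X s : MvPolynomial σ k)) (fun s => isHomogeneous_X k s)
    (fun y hy => funext fun s => by simpa using hy s)
  rwa [one_mul] at this

theorem AnT.mul_deg {k : Type*} [Field k] {σ τ : Type} {a b : ℕ} (h1 : AnT k σ a)
    (h2 : AnT k τ b) : AnT k (σ × τ) (a * b) := by
  obtain ⟨G, hG, hG0⟩ := h2
  have := h1.comp_sys (V := σ × τ) (J := σ) id Function.injective_id
    (fun s => rename (fun t => (s, t)) G) (fun s => hG.rename_isHomogeneous) (fun y hy => by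
      funext ⟨s, t⟩
      have h := hy s
      rw [eval_rename] at h
      exact congrFun (hG0 _ h) t)
  rwa [mul_comm] at this

theorem AnT.add_deg {k : Type*} [Field k] {σ : Type} {a b : ℕ} (h1 : AnT k σ a)
    (h2 : AnT k σ b) : AnT k σ (a + b) := by
  obtain ⟨F, hF, hF0⟩ := h1
  obtain ⟨G, hG, hG0⟩ := h2
  refine ⟨F * G, hF.mul hG, fun y hy => ?_⟩
  rw [map_mul, mul_eq_zero] at hy
  exact hy.elim (hF0 y) (hG0 y)

theorem AnT.one {k : Type*} [Field k] (d : ℕ) : AnT k (Fin 1) d := by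
  refine ⟨X 0 ^ d, isHomogeneous_X_pow _ _, fun y hy => ?_⟩
  funext i
  rw [Subsingleton.elim i 0]
  simpa using eq_zero_of_pow_eq_zero (by simpa using hy : (y 0) ^ d = 0)

theorem AnT.norm {k : Type*} [Field k] (K : Type*) [Field K] [Algebra k K]
    [FiniteDimensional k K] : AnT k (Fin (Module.finrank k K)) (Module.finrank k K) := by
  classical
  let b := Module.finBasis k K
  let A : Matrix (Fin (Module.finrank k K)) (Fin (Module.finrank k K))
    (MvPolynomial (Fin (Module.finrank k K)) k) :=
    fun r s => ∑ i, C (Algebra.leftMulMatrix b (b i) r s) * X i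
  refine ⟨A.det, ?_, fun y hy => ?_⟩
  · rw [Matrix.det_apply]
    apply IsHomogeneous.sum
    intro σ _
    have h : (∏ i, A (σ i) i).IsHomogeneous (∑ _i : Fin (Module.finrank k K), 1) :=
      IsHomogeneous.prod _ _ _ (fun i _ => IsHomogeneous.sum _ _ _
        (fun j _ => isHomogeneous_C_mul_X _ _))
    simp only [Finset.sum_const, Finset.card_univ, Fintype.card_fin, smul_eq_mul, mul_one] at h
    rcases Int.units_eq_one_or (Equiv.Perm.sign σ) with h1 | h1
    · rw [h1, one_smul]; exact h
    · rw [h1, Units.neg_smul, one_smul]; exact h.neg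
  · rw [RingHom.map_det] at hy
    have h1 : (eval y).mapMatrix A = Algebra.leftMulMatrix b (∑ i, y i • b i) := by
      ext r s
      have h2 : eval y (A r s) = ∑ i, Algebra.leftMulMatrix b (b i) r s * y i := by
        simp only [A, map_sum, map_mul, eval_C, eval_X]
      rw [RingHom.mapMatrix_apply, Matrix.map_apply, h2, map_sum, Matrix.sum_apply]
      refine Finset.sum_congr rfl (fun i _ => ?_)
      rw [map_smul, Matrix.smul_apply, smul_eq_mul, mul_comm]
    rw [h1, ← Algebra.norm_eq_matrix_det, Algebra.norm_eq_zero_iff] at hy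
    exact funext (Fintype.linearIndependent_iff.1 b.linearIndependent y hy)

theorem exists_prime_tower (k : Type*) [Field k] (hk : ¬ IsAlgClosed k) :
    ∃ p m : ℕ, p.Prime ∧ 1 ≤ m ∧ AnT k (Fin m) m ∧ AnT k (Fin (p * m)) (p * m) := by
  by_cases hs : IsSepClosed k
  · have hperf : ¬ PerfectField k := fun h => hk inferInstance
    obtain ⟨p, hp⟩ := ExpChar.exists k
    have hp' : p.Prime := by
      rcases hp with _ | hp
      · exact absurd (PerfectField.ofCharZero) hperf
      · assumption
    have hns : ¬ Function.Surjective (fun x : k => x ^ p) := by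
      intro h
      have : PerfectRing k p := PerfectRing.ofSurjective k p h
      exact hperf (PerfectRing.toPerfectField k p)
    rw [Function.Surjective] at hns
    push Not at hns
    obtain ⟨a, ha⟩ := hns
    have hirr := X_pow_sub_C_irreducible_of_prime hp' ha
    have := Fact.mk hirr
    have hne := hirr.ne_zero
    have : FiniteDimensional k (AdjoinRoot (Polynomial.X ^ p - Polynomial.C a)) :=
      (AdjoinRoot.powerBasis hne).finite
    have hfr : Module.finrank k (AdjoinRoot (Polynomial.X ^ p - Polynomial.C a)) = p := by
      rw [(AdjoinRoot.powerBasis hne).finrank, AdjoinRoot.powerBasis_dim,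
        Polynomial.natDegree_X_pow_sub_C]
    refine ⟨p, 1, hp', le_rfl, AnT.one 1, ?_⟩
    have := AnT.norm (k := k) (AdjoinRoot (Polynomial.X ^ p - Polynomial.C a))
    rw [hfr] at this
    simpa using this
  · obtain ⟨q, hqm, hqi, hqs, hq⟩ : ∃ q : Polynomial k, q.Monic ∧ Irreducible q ∧ q.Separable ∧
        ∀ x, q.eval x ≠ 0 := by
      by_contra hcon
      push Not at hcon
      exact hs (IsSepClosed.of_exists_root k hcon)
    have : IsGalois k q.SplittingField := IsGalois.of_separable_splitting_field hqs
    have hne : Module.finrank k q.SplittingField ≠ 1 := by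
      intro h1
      have hs := Polynomial.SplittingField.splits q
      have hb : (⊥ : Subalgebra k q.SplittingField) = ⊤ := Subalgebra.bot_eq_top_of_finrank_eq_one h1
      have hd : (q.map (algebraMap k q.SplittingField)).degree ≠ 0 := by
        rw [Polynomial.degree_map]; exact (Polynomial.degree_pos_of_irreducible hqi).ne'
      obtain ⟨x, hx⟩ := hs.exists_eval_eq_zero hd
      obtain ⟨z, rfl⟩ : ∃ z, algebraMap k q.SplittingField z = x := by
        have : x ∈ (⊥ : Subalgebra k q.SplittingField) := hb ▸ Algebra.mem_top
        exact Algebra.mem_bot.1 this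
      rw [Polynomial.eval_map_algebraMap, Polynomial.aeval_algebraMap_apply] at hx
      exact hq z (by simpa using hx)
    have hcard := IsGalois.card_aut_eq_finrank k q.SplittingField
    set p := (Module.finrank k q.SplittingField).minFac with hpdef
    have hp : p.Prime := Nat.minFac_prime hne
    have := Fact.mk hp
    have : Finite (q.SplittingField ≃ₐ[k] q.SplittingField) := inferInstance
    obtain ⟨g, hg⟩ := exists_prime_orderOf_dvd_card' (G := q.SplittingField ≃ₐ[k] q.SplittingField) p
      (by rw [hcard]; exact Nat.minFac_dvd _)
    let H := Subgroup.zpowers g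
    have hH : Module.finrank (IntermediateField.fixedField H) q.SplittingField = p := by
      rw [IntermediateField.finrank_fixedField_eq_card, Nat.card_zpowers, hg]
    have hmul := Module.finrank_mul_finrank k (IntermediateField.fixedField H) q.SplittingField
    rw [hH] at hmul
    refine ⟨p, Module.finrank k (IntermediateField.fixedField H), hp, Module.finrank_pos,
      AnT.norm _, ?_⟩
    rw [mul_comm, hmul]
    exact AnT.norm _

/-- The stabilised growth function. -/
noncomputable def muS (mm : ℕ → ℕ) (T : Set ℕ) (d : ℕ) : ℝ := ⨆ n : T, (mm (d * n) : ℝ) / (n : ℕ)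

theorem muS_bdd {mm : ℕ → ℕ} {T : Set ℕ} (hTpos : ∀ n ∈ T, 1 ≤ n)
    (hle : ∀ d, 1 ≤ d → mm d ≤ d) {d : ℕ} (hd : 1 ≤ d) (n : T) :
    (mm (d * n) : ℝ) / (n : ℕ) ≤ d := by
  have hn := hTpos n n.2
  rw [div_le_iff₀ (by exact_mod_cast hn)]
  exact_mod_cast hle (d * n) (Nat.mul_pos hd hn)

theorem le_muS {mm : ℕ → ℕ} {T : Set ℕ} (hTpos : ∀ n ∈ T, 1 ≤ n)
    (hle : ∀ d, 1 ≤ d → mm d ≤ d) {d : ℕ} (hd : 1 ≤ d) {n : ℕ} (hn : n ∈ T) :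
    (mm (d * n) : ℝ) ≤ n * muS mm T d := by
  have h0 : (0 : ℝ) < n := by exact_mod_cast hTpos n hn
  rw [mul_comm (n : ℝ), ← div_le_iff₀ h0]
  exact le_ciSup (f := fun n : T => (mm (d * n) : ℝ) / (n : ℕ))
    ⟨d, by rintro _ ⟨n, rfl⟩; exact muS_bdd hTpos hle hd n⟩ ⟨n, hn⟩

theorem exists_lt_muS {mm : ℕ → ℕ} {T : Set ℕ} (hT1 : 1 ∈ T) (hTpos : ∀ n ∈ T, 1 ≤ n)
    {d : ℕ} {x : ℝ} (hx : x < muS mm T d) :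
    ∃ n ∈ T, x * n < mm (d * n) := by
  haveI : Nonempty T := ⟨⟨1, hT1⟩⟩
  obtain ⟨n, hn⟩ := exists_lt_of_lt_ciSup hx
  have h0 : (0 : ℝ) < (n : ℕ) := by exact_mod_cast hTpos n n.2
  exact ⟨n, n.2, (lt_div_iff₀ h0).1 hn⟩

theorem numeric_contra (mm : ℕ → ℕ) (T : Set ℕ) (hT1 : 1 ∈ T) (hTpos : ∀ n ∈ T, 1 ≤ n)
    (hTmul : ∀ a ∈ T, ∀ b ∈ T, a * b ∈ T) (hTmm : ∀ n ∈ T, n ≤ mm n)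
    (h1 : ∀ d, 1 ≤ d → 1 ≤ mm d) (hle : ∀ d, 1 ≤ d → mm d ≤ d)
    (hmul : ∀ a b, 1 ≤ a → 1 ≤ b → mm a * mm b ≤ mm (a * b))
    (hadd : ∀ a b, 1 ≤ a → 1 ≤ b → min (mm a) (mm b) ≤ mm (a + b))
    (p m : ℕ) (hp : p.Prime) (hm : m ∈ T) (hpmT : p * m ∈ T)
    {ι : Type} [Fintype ι] [Nonempty ι] (d : ι → ℕ) (hd : ∀ i, 1 ≤ d i) (N : ℕ)
    (hN : ∑ i, d i < N)
    (hsys : ∀ (D n E c B : ℕ) (q a s : ι → ℕ), (∀ i, D = d i * q i) → (∀ i, 1 ≤ q i) →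
      n ∈ T → E ∈ T → (∀ i, c = s i * a i) → (∀ i, a i = mm (q i * n)) →
      B * ∑ i, s i ≤ E → B * c * N ≤ mm (D * n * E)) : False := by
  classical
  set mu := muS mm T with hmu
  have hL : ∀ {d n : ℕ}, 1 ≤ d → n ∈ T → (mm (d * n) : ℝ) ≤ n * mu d :=
    fun hd hn => le_muS hTpos hle hd hn
  have hX : ∀ {d : ℕ} {x : ℝ}, x < mu d → ∃ n ∈ T, x * n < mm (d * n) :=
    fun hx => exists_lt_muS hT1 hTpos hx
  have hmono : ∀ {d n n' : ℕ}, 1 ≤ d → 1 ≤ n → n' ∈ T → mm (d * n) * n' ≤ mm (d * (n * n')) := by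
    intro d n n' hd hn hn'
    rw [← mul_assoc]
    exact (Nat.mul_le_mul_left _ (hTmm n' hn')).trans
      (hmul _ _ (Nat.mul_pos hd hn) (hTpos n' hn'))
  have mu1 : ∀ d, 1 ≤ d → 1 ≤ mu d := by
    intro d hd
    have := hL hd hT1
    rw [mul_one, Nat.cast_one, one_mul] at this
    exact le_trans (by exact_mod_cast h1 d hd) this
  have mule : ∀ d, 1 ≤ d → mu d ≤ d := by
    intro d hd
    haveI : Nonempty T := ⟨⟨1, hT1⟩⟩
    exact ciSup_le fun n => muS_bdd hTpos hle hd n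
  have mumul : ∀ a b, 1 ≤ a → 1 ≤ b → mu a * mu b ≤ mu (a * b) := by
    intro a b ha hb
    by_contra! hlt
    have hb0 : 0 < mu b := lt_of_lt_of_le one_pos (mu1 b hb)
    have h2 : mu (a * b) / mu b < mu a := (div_lt_iff₀ hb0).2 hlt
    obtain ⟨n, hn, hn2⟩ := hX h2
    have hn0 : (0 : ℝ) < n := by exact_mod_cast hTpos n hn
    have hA : 0 < (mm (a * n) : ℝ) := by
      exact_mod_cast h1 (a * n) (Nat.mul_pos ha (hTpos n hn))
    have h3 : mu (a * b) * n / mm (a * n) < mu b := by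
      rw [div_lt_iff₀ hA]
      rw [div_mul_eq_mul_div, div_lt_iff₀ hb0] at hn2
      linarith
    obtain ⟨n', hn', hn'2⟩ := hX h3
    rw [div_mul_eq_mul_div, div_lt_iff₀ hA] at hn'2
    have h4 := hmul (a * n) (b * n') (Nat.mul_pos ha (hTpos n hn)) (Nat.mul_pos hb (hTpos n' hn'))
    have h5 := hL (Nat.mul_pos ha hb) (hTmul n hn n' hn')
    rw [show a * n * (b * n') = a * b * (n * n') by ring] at h4
    have h4' : (mm (a * n) : ℝ) * mm (b * n') ≤ mm (a * b * (n * n')) := by exact_mod_cast h4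
    push_cast at h5
    nlinarith
  have muadd : ∀ a b, 1 ≤ a → 1 ≤ b → min (mu a) (mu b) ≤ mu (a + b) := by
    intro a b ha hb
    by_contra! hlt
    obtain ⟨h2, h3⟩ := lt_min_iff.1 hlt
    obtain ⟨n, hn, hn2⟩ := hX h2
    obtain ⟨n', hn', hn'2⟩ := hX h3
    have p1 := hTpos n hn
    have p2 := hTpos n' hn'
    have q1 : (0 : ℝ) < n := by exact_mod_cast p1
    have q2 : (0 : ℝ) < n' := by exact_mod_cast p2
    have h4 := hadd (a * (n * n')) (b * (n * n')) (Nat.mul_pos ha (Nat.mul_pos p1 p2))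
      (Nat.mul_pos hb (Nat.mul_pos p1 p2))
    rw [← add_mul] at h4
    have h5 := hL (show 1 ≤ a + b by omega) (hTmul n hn n' hn')
    have h6 := hmono ha p1 hn'
    have h7 := hmono hb p2 hn
    rw [mul_comm n' n] at h7
    have h6' : (mm (a * n) : ℝ) * n' ≤ mm (a * (n * n')) := by exact_mod_cast h6
    have h7' : (mm (b * n') : ℝ) * n ≤ mm (b * (n * n')) := by exact_mod_cast h7
    push_cast at h5
    rcases min_le_iff.1 h4 with h | h
    · have h' : (mm (a * (n * n')) : ℝ) ≤ mm ((a + b) * (n * n')) := by exact_mod_cast h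
      nlinarith
    · have h' : (mm (b * (n * n')) : ℝ) ≤ mm ((a + b) * (n * n')) := by exact_mod_cast h
      nlinarith
  have hm0 : (0 : ℝ) < m := by exact_mod_cast hTpos m hm
  have hp0 : (0 : ℝ) < p := by exact_mod_cast hp.pos
  have mup : ∀ d, 1 ≤ d → mu (p * d) = p * mu d := by
    intro d hd
    apply le_antisymm
    · by_contra! hlt
      obtain ⟨n, hn, hn2⟩ := hX hlt
      have h6 := hmono (Nat.mul_pos hp.pos hd) (hTpos n hn) hm
      have h5 := hL hd (hTmul n hn _ hpmT)
      rw [show p * d * (n * m) = d * (n * (p * m)) by ring] at h6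
      have h6' : (mm (p * d * n) : ℝ) * m ≤ mm (d * (n * (p * m))) := by exact_mod_cast h6
      push_cast at h5
      nlinarith
    · by_contra! hlt
      have hlt' : mu (p * d) / p < mu d := by
        rw [div_lt_iff₀ hp0]; linarith
      obtain ⟨n, hn, hn2⟩ := hX hlt'
      rw [div_mul_eq_mul_div, div_lt_iff₀ hp0] at hn2
      have h6 := hmono hd (hTpos n hn) hpmT
      have h5 := hL (Nat.mul_pos hp.pos hd) (hTmul n hn _ hm)
      rw [show d * (n * (p * m)) = p * d * (n * m) by ring] at h6
      have h6' : (mm (d * n) : ℝ) * (p * m) ≤ mm (p * d * (n * m)) := by exact_mod_cast h6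
      push_cast at h5
      nlinarith
  set S := ∑ i, d i with hS
  have hS0 : (0 : ℝ) ≤ S := by positivity
  set ε : ℝ := 1 / (3 * (S + 1)) with hε
  have hε0 : 0 < ε := by positivity
  obtain ⟨D, hD1, hD⟩ := exists_good_degree mu mu1 mule mumul muadd p hp mup d hd ε hε0
  choose q hq hq1 hqm using hD
  have hn : ∀ i, ∃ n ∈ T, mu (q i) * n < (1 + ε) * mm (q i * n) := by
    intro i
    have : mu (q i) / (1 + ε) < mu (q i) := by
      have := mu1 (q i) (hq1 i)
      rw [div_lt_iff₀ (by positivity)]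
      nlinarith
    obtain ⟨n, hn, hn2⟩ := hX this
    refine ⟨n, hn, ?_⟩
    rw [div_mul_eq_mul_div, div_lt_iff₀ (by positivity)] at hn2
    linarith
  choose nn hnnT hnn using hn
  have hprodT : ∀ s : Finset ι, ∏ i ∈ s, nn i ∈ T := by
    intro s
    induction s using Finset.induction_on with
    | empty => simpa using hT1
    | insert i s hi ih => rw [Finset.prod_insert hi]; exact hTmul _ (hnnT i) _ ih
  set n := ∏ i, nn i with hndef
  have hnT : n ∈ T := hprodT _
  have hnpos := hTpos n hnT
  set a : ι → ℕ := fun i => mm (q i * n) with ha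
  have ha1 : ∀ i, 1 ≤ a i := fun i => h1 _ (Nat.mul_pos (hq1 i) hnpos)
  have hna : ∀ i, n * mu (q i) ≤ (1 + ε) * a i := by
    intro i
    have e : nn i * ∏ j ∈ Finset.univ.erase i, nn j = n := Finset.mul_prod_erase _ _ (Finset.mem_univ i)
    have hr := hprodT (Finset.univ.erase i)
    set r := ∏ j ∈ Finset.univ.erase i, nn j
    have h6 := hmono (hq1 i) (hTpos _ (hnnT i)) hr
    rw [e] at h6
    have h6' : (mm (q i * nn i) : ℝ) * r ≤ a i := by exact_mod_cast h6
    have e' : (n : ℝ) = nn i * r := by exact_mod_cast e.symm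
    have hr0 : (0 : ℝ) < r := by exact_mod_cast hTpos r hr
    rw [e']
    calc (nn i : ℝ) * r * mu (q i) = (mu (q i) * nn i) * r := by ring
      _ ≤ ((1 + ε) * mm (q i * nn i)) * r := by
          exact mul_le_mul_of_nonneg_right (hnn i).le hr0.le
      _ = (1 + ε) * (mm (q i * nn i) * r) := by ring
      _ ≤ _ := by gcongr
  set c := ∏ i, a i with hc
  set s : ι → ℕ := fun i => ∏ j ∈ Finset.univ.erase i, a j with hs
  have hcs : ∀ i, c = s i * a i := fun i => (Finset.prod_erase_mul _ _ (Finset.mem_univ i)).symm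
  have hc0 : (0 : ℝ) < c := by
    have : 0 < c := Finset.prod_pos fun i _ => ha1 i
    exact_mod_cast this
  have hs1 : ∀ i, 0 < s i := fun i => Finset.prod_pos fun j _ => ha1 j
  set ss := ∑ i, s i with hss
  have hss0 : 0 < ss := Finset.sum_pos (fun i _ => hs1 i) Finset.univ_nonempty
  have hss0' : (0 : ℝ) < ss := by exact_mod_cast hss0
  have hEpow : ∀ t, (p * m) ^ t ∈ T := by
    intro t
    induction t with
    | zero => simpa using hT1
    | succ t ih => rw [pow_succ]; exact hTmul _ ih _ hpmT
  have hn0 : (0 : ℝ) < n := by exact_mod_cast hnpos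
  have hmuD : 0 < mu D := lt_of_lt_of_le one_pos (mu1 D hD1)
  have key : (c : ℝ) * N ≤ n * ss * mu D := by
    by_contra! hlt
    obtain ⟨B0, hB0⟩ := exists_nat_gt ((n * ss * mu D) / (c * N - n * ss * mu D))
    rw [div_lt_iff₀ (by linarith)] at hB0
    have hpm2 : 1 < p * m := by
      have := hp.two_le
      have := hTpos m hm
      nlinarith
    obtain ⟨t, ht⟩ := pow_unbounded_of_one_lt (ss * B0) hpm2
    set E := (p * m) ^ t
    set B := E / ss with hB
    have hBB : B0 ≤ B := by
      rw [hB, Nat.le_div_iff_mul_le hss0]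
      nlinarith
    have hBE : B * ss ≤ E := Nat.div_mul_le_self _ _
    have hEB : E < ss * (B + 1) := Nat.lt_mul_div_succ E hss0
    have h := hsys D n E c B q a s hq hq1 hnT (hEpow t) hcs (fun i => rfl) hBE
    have h' := hL hD1 (hTmul n hnT E (hEpow t))
    rw [← mul_assoc] at h'
    have h2 : (B : ℝ) * c * N ≤ mm (D * n * E) := by exact_mod_cast h
    push_cast at h'
    have hEB' : (E : ℝ) ≤ ss * (B + 1) := by exact_mod_cast hEB.le
    have h3 : (n : ℝ) * E * mu D ≤ n * (ss * (B + 1)) * mu D := by gcongr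
    have hBB' : (B0 : ℝ) ≤ B := by exact_mod_cast hBB
    nlinarith
  have h7 : (n : ℝ) * ss * mu D ≤ (1 + ε) ^ 2 * S * c := by
    rw [hss, hS]
    push_cast
    rw [Finset.mul_sum, Finset.sum_mul, Finset.mul_sum, Finset.sum_mul]
    apply Finset.sum_le_sum
    intro i _
    have e : (c : ℝ) = s i * a i := by exact_mod_cast hcs i
    rw [e]
    have hsi : (0 : ℝ) ≤ s i := by positivity
    calc (n : ℝ) * s i * mu D ≤ n * s i * ((1 + ε) * d i * mu (q i)) := by
          gcongr; exact hqm i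
      _ = s i * (1 + ε) * d i * (n * mu (q i)) := by ring
      _ ≤ s i * (1 + ε) * d i * ((1 + ε) * a i) :=
          mul_le_mul_of_nonneg_left (hna i) (by positivity)
      _ = _ := by ring
  have h8 : (N : ℝ) ≤ (1 + ε) ^ 2 * S := by
    have : (c : ℝ) * N ≤ c * ((1 + ε) ^ 2 * S) := by linarith
    exact le_of_mul_le_mul_left this hc0
  have h9 : (S : ℝ) + 1 ≤ N := by exact_mod_cast hN
  have hε3 : ε * (3 * (S + 1)) = 1 := by rw [hε]; field_simp
  have hε1 : ε ≤ 1 := by nlinarith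
  have : (1 + ε) ^ 2 ≤ 1 + 3 * ε := by nlinarith
  have : (1 + ε) ^ 2 * S ≤ (1 + 3 * ε) * S := by gcongr
  nlinarith

/-- Largest number of variables of an anisotropic form of degree `d`. -/
noncomputable def mmax (k : Type*) [Field k] (d : ℕ) : ℕ := sSup {N | AnT k (Fin N) d}

theorem AnT.of_card {k : Type*} [Field k] {σ τ : Type} [Fintype σ] [Fintype τ] {d : ℕ}
    (h : Fintype.card σ ≤ Fintype.card τ) (hτ : AnT k τ d) : AnT k σ d := by
  obtain ⟨e⟩ := Function.Embedding.nonempty_of_card_le h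
  exact hτ.restrict e e.injective

theorem AnT.sys {k : Type*} [Field k] {ι : Type} [Fintype ι] {N : ℕ}
    (f : ι → MvPolynomial (Fin N) k) (d : ι → ℕ) (hf : ∀ i, (f i).IsHomogeneous (d i))
    (han : ∀ y : Fin N → k, (∀ i, eval y (f i) = 0) → y = 0) [Nonempty ι]
    (D n E c B : ℕ) (q a s : ι → ℕ) (hD : ∀ i, D = d i * q i) (hE : AnT k (Fin E) E)
    (hc : ∀ i, c = s i * a i) (ha : ∀ i, AnT k (Fin (a i)) (q i * n))
    (hB : B * ∑ i, s i ≤ E) : AnT k (Fin (B * c * N)) (D * n * E) := by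
  classical
  choose Ψ hΨ hΨ0 using ha
  let e : ∀ i, Fin (s i) × Fin (a i) ≃ Fin c := fun i =>
    finProdFinEquiv.trans (finCongr (hc i).symm)
  have hcard : Fintype.card (Fin B × (Σ i, Fin (s i))) ≤ Fintype.card (Fin E) := by
    simpa [Fintype.card_prod, Fintype.card_sigma] using hB
  obtain ⟨emb⟩ := Function.Embedding.nonempty_of_card_le hcard
  have main : AnT k (Fin B × Fin c × Fin N) (D * n * E) := by
    refine hE.comp_sys (J := Fin B × (Σ i, Fin (s i))) emb emb.injective
      (fun j => aeval (fun t : Fin (a j.2.1) =>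
        rename (fun v : Fin N => (j.1, e j.2.1 (j.2.2, t), v)) (f j.2.1)) (Ψ j.2.1)) ?_ ?_
    · rintro ⟨b, i, x⟩
      have := (hΨ i).aeval (fun t : Fin (a i) =>
        rename (fun v : Fin N => (b, e i (x, t), v)) (f i)) (n := d i)
        (fun t => (hf i).rename_isHomogeneous)
      rwa [← mul_assoc, ← hD i] at this
    · intro y hy
      funext ⟨b, z, v⟩
      have hz : (fun v => y (b, z, v)) = 0 := by
        apply han
        intro i
        obtain ⟨⟨x, t⟩, rfl⟩ := (e i).surjective z
        have h := hy (b, ⟨i, x⟩)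
        have h1 : eval y (aeval (fun t : Fin (a i) =>
            rename (fun v : Fin N => (b, e i (x, t), v)) (f i)) (Ψ i)) =
            eval (fun t => eval y (rename (fun v : Fin N => (b, e i (x, t), v)) (f i))) (Ψ i) := by
          rw [← coe_aeval_eq_eval y, ← coe_aeval_eq_eval]
          exact DFunLike.congr_fun (MvPolynomial.algHom_ext (f := (aeval y).comp (aeval _))
            (g := aeval (fun t => aeval y (rename (fun v : Fin N => (b, e i (x, t), v)) (f i))))
            (fun i => by simp only [AlgHom.comp_apply, aeval_X])) (Ψ i)
        have h2 := congrFun (hΨ0 i _ (h1.symm.trans h)) t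
        rw [eval_rename] at h2
        exact h2
      exact congrFun hz v
  refine main.of_card ?_
  simp [Fintype.card_prod, mul_assoc]

theorem sys_zero {k : Type*} [Field k]
    (hC1 : ∀ (N d : ℕ), 1 ≤ d → d < N →
      ∀ g : MvPolynomial (Fin N) k, g.IsHomogeneous d →
        ∃ y : Fin N → k, y ≠ 0 ∧ eval y g = 0)
    (N : ℕ) (ι : Type) [Fintype ι] (g : ι → MvPolynomial (Fin N) k) (δ : ι → ℕ)
    (hδ : ∀ i, 1 ≤ δ i) (hg : ∀ i, (g i).IsHomogeneous (δ i)) (hN : ∑ i, δ i < N) :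
    ∃ y : Fin N → k, y ≠ 0 ∧ ∀ i, eval y (g i) = 0 := by
  by_cases hk : IsAlgClosed k
  · obtain ⟨y, hy, hy0⟩ := algClosed_zero g (fun i => by
      rw [eval_zero, constantCoeff_eq]
      by_contra h0
      have h1 := hg i h0
      have h2 := hδ i
      simp at h1
      omega) (by
      refine lt_of_le_of_lt ?_ hN
      calc Fintype.card ι = ∑ i : ι, 1 := by simp
        _ ≤ _ := Finset.sum_le_sum fun i _ => hδ i)
    exact ⟨y, hy, hy0⟩
  by_contra! hcon
  have han : ∀ y : Fin N → k, (∀ i, eval y (g i) = 0) → y = 0 := by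
    intro y hy
    by_contra h
    obtain ⟨i, hi⟩ := hcon y h
    exact hi (hy i)
  rcases isEmpty_or_nonempty ι with hι | hι
  · have h := han (fun _ => 1) (fun i => hι.elim i)
    exact one_ne_zero (congrFun h ⟨0, by omega⟩)
  have hb : ∀ d N, 1 ≤ d → AnT k (Fin N) d → N ≤ d := by
    rintro d N hd ⟨F, hF, hF0⟩
    by_contra! h
    obtain ⟨y, hy, hy0⟩ := hC1 N d hd h F hF
    exact hy (hF0 y hy0)
  have hbdd : ∀ d, 1 ≤ d → BddAbove {N | AnT k (Fin N) d} := fun d hd =>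
    ⟨d, fun N hN => hb d N hd hN⟩
  have hne : ∀ d, {N | AnT k (Fin N) d}.Nonempty := fun d => ⟨1, AnT.one d⟩
  have hmem : ∀ d, 1 ≤ d → AnT k (Fin (mmax k d)) d := fun d hd =>
    Nat.sSup_mem (hne d) (hbdd d hd)
  have hlem : ∀ d N, 1 ≤ d → AnT k (Fin N) d → N ≤ mmax k d := fun d N hd h =>
    le_csSup (hbdd d hd) h
  obtain ⟨p, m, hp, hm, hmT, hpmT⟩ := exists_prime_tower k hk
  refine numeric_contra (mmax k) {n | 1 ≤ n ∧ AnT k (Fin n) n} ⟨le_rfl, AnT.one 1⟩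
    (fun n hn => hn.1) ?_ (fun n hn => hlem n n hn.1 hn.2)
    (fun d hd => hlem d 1 hd (AnT.one d)) (fun d hd => hb d _ hd (hmem d hd)) ?_ ?_ p m hp
    ⟨hm, hmT⟩ ⟨Nat.mul_pos hp.pos hm, hpmT⟩ δ hδ N hN ?_
  · rintro a ⟨ha, ha'⟩ b ⟨hb, hb'⟩
    exact ⟨Nat.mul_pos ha hb, (ha'.mul_deg hb').of_card (by simp)⟩
  · intro a b ha hb
    exact hlem _ _ (Nat.mul_pos ha hb) (((hmem a ha).mul_deg (hmem b hb)).of_card (by simp))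
  · intro a b ha hb
    exact hlem _ _ (by omega) (((hmem a ha).of_card (by simp)).add_deg
      ((hmem b hb).of_card (by simp)))
  · intro D n E c B q a s hD hq hn hE hc ha hB
    obtain ⟨i⟩ := hι
    haveI : Nonempty ι := ⟨i⟩
    refine hlem _ _ ?_ (AnT.sys g δ hg han D n E c B q a s hD hE.2 hc (fun i => ?_) hB)
    · rw [hD i]
      exact Nat.mul_pos (Nat.mul_pos (Nat.mul_pos (hδ i) (hq i)) hn.1) hE.1
    · rw [ha i]
      exact hmem _ (Nat.mul_pos (hq i) hn.1)


theorem isHomogeneous_aeval_smul {k R σ : Type*} [Field k] [CommRing R] [Algebra k R]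
    {g : MvPolynomial σ k} {j : ℕ} (hg : g.IsHomogeneous j) (t : R) (c : σ → R) :
    aeval (fun m => t * c m) g = t ^ j * aeval c g := by
  rw [aeval_def, aeval_def, eval₂_eq, eval₂_eq, Finset.mul_sum]
  refine Finset.sum_congr rfl (fun e he => ?_)
  have h1 : ∑ i ∈ e.support, e i = j := by
    have := hg (mem_support_iff.1 he)
    rw [← this, Finsupp.weight_apply, Finsupp.sum]
    simp
  simp_rw [mul_pow]
  rw [Finset.prod_mul_distrib, Finset.prod_pow_eq_pow_sum, h1]
  ring

/-- Expansion of `f(s·a + X)` in powers of `s`. -/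
theorem exists_expansion {k : Type*} [Field k] {n d : ℕ} (f : MvPolynomial (Fin (n + 1)) k)
    (hf : f.IsHomogeneous d) (hd : 1 ≤ d) (a : Fin (n + 1) → k) (ha : eval a f = 0) :
    ∃ A : ℕ → MvPolynomial (Fin (n + 1)) k, A 0 = f ∧ (∀ l ≤ d, (A l).IsHomogeneous (d - l)) ∧
      ∀ c : Fin (n + 1) → k, (∀ l < d, eval c (A l) = 0) →
        aeval (fun m => C (a m) * X 0 + C (c m) * X 1) f = (0 : MvPolynomial (Fin 2) k) := by
  let P : MvPolynomial (Fin (n + 2)) k := aeval (fun m => C (a m) * X 0 + X (Fin.succ m)) f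
  have hP : P.IsHomogeneous d := by
    have : P.IsHomogeneous (1 * d) := hf.aeval _ (fun m =>
      (isHomogeneous_C_mul_X _ _).add (isHomogeneous_X _ _))
    rwa [one_mul] at this
  let A : ℕ → MvPolynomial (Fin (n + 1)) k := fun l => (finSuccEquiv k (n + 1) P).coeff l
  have hA : ∀ l ≤ d, (A l).IsHomogeneous (d - l) := fun l hl =>
    hP.finSuccEquiv_coeff_isHomogeneous l (d - l) (by omega)
  have hdeg : (finSuccEquiv k (n + 1) P).natDegree < d + 1 := by
    rw [natDegree_finSuccEquiv]
    exact Nat.lt_succ_of_le ((degreeOf_le_totalDegree _ _).trans hP.totalDegree_le)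
  -- evaluation
  have hev : ∀ {R : Type _} [CommRing R] [Algebra k R] (s : R) (v : Fin (n + 1) → R),
      aeval (fun m => algebraMap k R (a m) * s + v m) f =
        ∑ l ∈ Finset.range (d + 1), aeval v (A l) * s ^ l := by
    intro R _ _ s v
    have e1 : aeval (fun m => algebraMap k R (a m) * s + v m) f =
        aeval (Fin.cons s v : Fin (n + 2) → R) P := by
      refine DFunLike.congr_fun (MvPolynomial.algHom_ext (g := (aeval (Fin.cons s v)).comp
        (aeval (fun m => C (a m) * X 0 + X (Fin.succ m)))) (fun i => ?_)) f
      simp only [AlgHom.comp_apply, aeval_X, map_add, map_mul, aeval_C, algHom_C]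
      simp
    have e2 : aeval (Fin.cons s v : Fin (n + 2) → R) P =
        Polynomial.eval₂ (aeval v).toRingHom s (finSuccEquiv k (n + 1) P) := by
      let ψ : MvPolynomial (Fin (n + 2)) k →ₐ[k] R :=
        { ((Polynomial.eval₂RingHom (aeval v).toRingHom s).comp
            (finSuccEquiv k (n + 1)).toAlgHom.toRingHom) with
          commutes' := fun r => by
            show Polynomial.eval₂ (aeval v).toRingHom s (finSuccEquiv k (n + 1) (C r)) = _
            simp [finSuccEquiv_apply, MvPolynomial.eval₂_C] }
      have : (aeval (Fin.cons s v : Fin (n + 2) → R)) = ψ := by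
        apply MvPolynomial.algHom_ext
        intro i
        show _ = Polynomial.eval₂ (aeval v).toRingHom s (finSuccEquiv k (n + 1) (X i))
        refine Fin.cases ?_ (fun j => ?_) i
        · simp [finSuccEquiv_X_zero]
        · simp [finSuccEquiv_X_succ]
      exact DFunLike.congr_fun this P
    rw [e1, e2, Polynomial.eval₂_eq_sum_range' _ hdeg]
    rfl
  refine ⟨A, ?_, hA, ?_⟩
  · have h := hev (R := MvPolynomial (Fin (n + 1)) k) 0 X
    rw [Finset.sum_range_succ'] at h
    simp only [mul_zero, zero_add, pow_zero, mul_one] at h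
    rw [Finset.sum_eq_zero (fun l _ => by rw [pow_succ, mul_zero, mul_zero]), zero_add] at h
    simpa using h.symm
  · intro c hc
    have hAd : eval c (A d) = 0 := by
      have h := hev (R := k) 1 0
      have h0 := hA d le_rfl
      rw [Nat.sub_self] at h0
      obtain ⟨r, hr⟩ : ∃ r, A d = C r :=
        ⟨_, (totalDegree_eq_zero_iff_eq_C).1 ((totalDegree_zero_iff_isHomogeneous _).2 h0)⟩
      rw [Finset.sum_range_succ, Finset.sum_eq_zero (fun l hl => ?_)] at h
      · simp only [Algebra.algebraMap_self, RingHom.id_apply, mul_one, Pi.zero_apply, add_zero,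
          one_pow, zero_add, coe_aeval_eq_eval] at h
        rw [hr] at h ⊢
        rw [aeval_C] at h
        rw [eval_C]
        exact h.symm.trans ha
      · have hl' := Finset.mem_range.1 hl
        have := isHomogeneous_aeval_smul (hA l hl'.le) (0 : k) (0 : Fin (n + 1) → k)
        rw [zero_pow (by omega), zero_mul] at this
        simp only [Pi.zero_apply, mul_zero] at this
        rw [one_pow, mul_one]
        exact this
    have h := hev (R := MvPolynomial (Fin 2) k) (X 0) (fun m => X 1 * C (c m))
    have h2 : (fun m => C (a m) * X 0 + C (c m) * X 1 : Fin (n + 1) → MvPolynomial (Fin 2) k) =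
        fun m => algebraMap k _ (a m) * X 0 + X 1 * C (c m) := by
      funext m; rw [algebraMap_eq, mul_comm (X 1)]
    rw [h2, h]
    apply Finset.sum_eq_zero
    intro l hl
    have hl' : l ≤ d := Nat.lt_succ_iff.1 (Finset.mem_range.1 hl)
    rw [isHomogeneous_aeval_smul (hA l hl')]
    have h3 : aeval (fun m => (C (c m) : MvPolynomial (Fin 2) k)) (A l) = C (eval c (A l)) := by
      have := aeval_algebraMap_apply (MvPolynomial (Fin 2) k) c (A l)
      exact this
    have h4 : eval c (A l) = 0 := by
      rcases hl'.lt_or_eq with h | h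
      · exact hc l h
      · rw [h]; exact hAd
    rw [h3, h4, map_zero, mul_zero, zero_mul]

/-- Final step, from the zero property for systems. -/
theorem final_step {k : Type*} [Field k]
    (hsys : ∀ (N : ℕ) (ι : Type) [Fintype ι] (g : ι → MvPolynomial (Fin N) k) (δ : ι → ℕ),
      (∀ i, 1 ≤ δ i) → (∀ i, (g i).IsHomogeneous (δ i)) → ∑ i, δ i < N →
      ∃ y : Fin N → k, y ≠ 0 ∧ ∀ i, eval y (g i) = 0)
    (n r : ℕ) (f : Fin r → MvPolynomial (Fin (n + 1)) k) (d : Fin r → ℕ)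
    (hd : ∀ i, 1 ≤ d i) (hhom : ∀ i, (f i).IsHomogeneous (d i))
    (hsum : ∑ i, d i ^ 2 ≤ n)
    (a b : Fin (n + 1) → k)
    (ha : ∀ i, eval a (f i) = 0) (hb : ∀ i, eval b (f i) = 0) :
    ∃ c : Fin (n + 1) → k, c ≠ 0 ∧ ∀ i,
      aeval (fun m => C (a m) * X 0 + C (c m) * X 1) (f i) = (0 : MvPolynomial (Fin 2) k) ∧
      aeval (fun m => C (b m) * X 0 + C (c m) * X 1) (f i) = (0 : MvPolynomial (Fin 2) k) := by
  choose A hA0 hAh hA using fun i => exists_expansion (f i) (hhom i) (hd i) a (ha i)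
  choose B hB0 hBh hB using fun i => exists_expansion (f i) (hhom i) (hd i) b (hb i)
  obtain ⟨c, hc0, hc⟩ := hsys (n + 1) (Σ i : Fin r, Fin (d i) ⊕ Fin (d i - 1))
    (fun x => Sum.elim (fun l => A x.1 l.val) (fun l => B x.1 (l.val + 1)) x.2)
    (fun x => Sum.elim (fun l => d x.1 - l.val) (fun l => d x.1 - (l.val + 1)) x.2)
    (by
      rintro ⟨i, l | l⟩
      · simp only [Sum.elim_inl]; have := l.isLt; omega
      · simp only [Sum.elim_inr]; have := l.isLt; omega)
    (by
      rintro ⟨i, l | l⟩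
      · exact hAh i _ l.isLt.le
      · exact hBh i _ (by have := l.isLt; omega))
    (by
      rw [Fintype.sum_sigma]
      refine lt_of_le_of_lt (le_trans (Finset.sum_le_sum (fun i _ => ?_)) hsum) (Nat.lt_succ_self n)
      rw [Fintype.sum_sum_type]
      simp only [Sum.elim_inl, Sum.elim_inr]
      obtain ⟨e, he⟩ : ∃ e, d i = e + 1 := ⟨d i - 1, by have := hd i; omega⟩
      rw [he, Nat.add_sub_cancel, Fin.sum_univ_eq_sum_range (fun l => e + 1 - l),
        Fin.sum_univ_eq_sum_range (fun l => e + 1 - (l + 1))]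
      clear he
      have h1 : ∀ e : ℕ, ∑ l ∈ Finset.range e, (e - l) + ∑ l ∈ Finset.range e, l = e * e := by
        intro e
        rw [← Finset.sum_add_distrib, Finset.sum_congr rfl (g := fun _ => e)
          (fun l hl => by have := Finset.mem_range.1 hl; omega)]
        simp
      have h2 := Finset.sum_range_id_mul_two (e + 1)
      have h3 := Finset.sum_range_succ (fun l => l) e
      have h4 := h1 (e + 1)
      have h5 := h1 e
      simp only [Nat.add_sub_cancel, Nat.add_sub_add_right] at *
      nlinarith)
  refine ⟨c, hc0, fun i => ⟨hA i c (fun l hl => hc ⟨i, Sum.inl ⟨l, hl⟩⟩), hB i c (fun l hl => ?_)⟩⟩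
  rcases l with _ | l
  · rw [hB0, ← hA0]
    exact hc ⟨i, Sum.inl ⟨0, hl⟩⟩
  · exact hc ⟨i, Sum.inr ⟨l, by omega⟩⟩


/-- If `k` is a `C₁` field, `f₁, …, f_r ∈ k[X₀, …, X_n]` are homogeneous of degrees
`d₁, …, d_r ≥ 1` with `∑ dᵢ² ≤ n`, and `a, b ∈ k^{n+1}` are linearly independent common
zeros of the `fᵢ`, then there is a nonzero `c ∈ k^{n+1}` such that for each `i` the
polynomials `fᵢ(s·a + t·c)` and `fᵢ(s·b + t·c)` are zero in `k[s,t]`. -/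
theorem statement0 {k : Type*} [Field k]
    (hC1 : ∀ (N d : ℕ), 1 ≤ d → d < N →
      ∀ g : MvPolynomial (Fin N) k, g.IsHomogeneous d →
        ∃ y : Fin N → k, y ≠ 0 ∧ eval y g = 0)
    (n r : ℕ) (f : Fin r → MvPolynomial (Fin (n + 1)) k) (d : Fin r → ℕ)
    (hd : ∀ i, 1 ≤ d i) (hhom : ∀ i, (f i).IsHomogeneous (d i))
    (hsum : ∑ i, d i ^ 2 ≤ n)
    (a b : Fin (n + 1) → k) (hab : LinearIndependent k ![a, b])
    (ha : ∀ i, eval a (f i) = 0) (hb : ∀ i, eval b (f i) = 0) :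
    ∃ c : Fin (n + 1) → k, c ≠ 0 ∧ ∀ i,
      aeval (fun m => C (a m) * X 0 + C (c m) * X 1) (f i) = (0 : MvPolynomial (Fin 2) k) ∧
      aeval (fun m => C (b m) * X 0 + C (c m) * X 1) (f i) = (0 : MvPolynomial (Fin 2) k) := by
  exact final_step (fun N ι _ g δ h1 h2 h3 => sys_zero hC1 N ι g δ h1 h2 h3)
    n r f d hd hhom hsum a b ha hb
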